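/- arXiv:1104.2559 — 2 statements merged into one kernel-verified Lean document; each statement's English description precedes it below -/
import Mathlib

section
/- Let A₁B₁C₁, A₂B₂C₂, A₃B₃C₃ be three triangles in the real plane ℝ² that are pairwise homological, such that all three pairs have the same homology axis: there exist collinear points M, N, P with M on all three lines B₁C₁, B₂C₂, B₃C₃, with N on all three lines C₁A₁, C₂A₂, C₃A₃, and with P on all three lines A₁B₁, A₂B₂, A₃B₃. Let O₁ be the homology center of A₁B₁C₁ and A₂B₂C₂, O₂ the homology center of A₂B₂C₂ and A₃B₃C₃, and O₃ the homology center of A₃B₃C₃ and A₁B₁C₁. Then O₁, O₂, O₃ are collinear. -/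
/-- The line through two points of the real affine plane ℝ × ℝ. -/
noncomputable def line (P Q : ℝ × ℝ) : AffineSubspace ℝ (ℝ × ℝ) := affineSpan ℝ {P, Q}

/-- Two lines with a common point and parallel direction vectors coincide. -/
theorem affineSpan_pair_eq_of_mem_of_smul_eq {k V : Type*} [Field k] [AddCommGroup V] [Module k V]
    {A A' B B' O : V} {c d : k}
    (hOA : O ∈ affineSpan k {A, A'}) (hOB : O ∈ affineSpan k {B, B'})
    (hc : c ≠ 0) (hd : d ≠ 0) (h : c • (A' - A) = d • (B' - B)) :
    affineSpan k {A, A'} = affineSpan k {B, B'} := by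
  refine AffineSubspace.ext_of_direction_eq ?_ ⟨O, hOA, hOB⟩
  rw [direction_affineSpan, direction_affineSpan, vectorSpan_pair_rev, vectorSpan_pair_rev,
    vsub_eq_sub, vsub_eq_sub, ← Submodule.span_singleton_smul_eq hc.isUnit, h,
    Submodule.span_singleton_smul_eq hd.isUnit]

/-- If the lines `AB` and `A'B'` meet at `P`, with parameters `t` and `s`, and the distinct lines
`AA'` and `BB'` meet at `O`, then `s ≠ t` and `O` is the point of `AA'` with weights
proportional to `1 - t` and `-(1 - s)`. -/
theorem sub_smul_eq_of_lineMap_eq_lineMap {k V : Type*} [Field k] [AddCommGroup V] [Module k V]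
    {A A' B B' O : V} {t s : k} (hA : A ≠ A') (hB : B ≠ B')
    (hne : affineSpan k {A, A'} ≠ affineSpan k {B, B'})
    (hOA : O ∈ affineSpan k {A, A'}) (hOB : O ∈ affineSpan k {B, B'})
    (hP : AffineMap.lineMap A B t = AffineMap.lineMap A' B' s) :
    s ≠ t ∧ (s - t) • O = (1 - t) • A - (1 - s) • A' := by
  obtain ⟨r, hr⟩ := mem_affineSpan_pair_iff_exists_lineMap_eq.1 hOA
  obtain ⟨q, hq⟩ := mem_affineSpan_pair_iff_exists_lineMap_eq.1 hOB
  simp only [AffineMap.lineMap_apply_module] at hr hq hP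
  have key : (s - 1 - (s - t) * r) • (A' - A) = (s - (s - t) * q) • (B' - B) := by
    linear_combination (norm := module) hP - (s - t) • hr + (s - t) • hq
  have hc : s - 1 - (s - t) * r = 0 := by
    by_contra hc
    have hd : s - (s - t) * q ≠ 0 := by
      intro hd
      rw [hd, zero_smul, smul_eq_zero, sub_eq_zero (a := A')] at key
      exact key.elim hc hA.symm
    exact hne (affineSpan_pair_eq_of_mem_of_smul_eq hOA hOB hc hd key)
  have hd : s - (s - t) * q = 0 := by
    rw [hc, zero_smul, eq_comm, smul_eq_zero, sub_eq_zero (a := B')] at key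
    exact key.resolve_right hB.symm
  refine ⟨?_, ?_⟩
  · rintro rfl
    exact one_ne_zero (α := k) (by linear_combination hd - hc)
  · rw [← hr]
    linear_combination (norm := module) hc • (A - A')

/-- **Theorem 2.** If three triangles are pairwise homological with a common homology
axis (through the collinear points `M`, `N`, `P`), then their three homology centers
`O₁`, `O₂`, `O₃` are collinear. -/
theorem homology_centers_collinear_of_common_axis
    (A₁ B₁ C₁ A₂ B₂ C₂ A₃ B₃ C₃ M N P O₁ O₂ O₃ : ℝ × ℝ)
    -- the three triangles
    (hT₁ : AffineIndependent ℝ ![A₁, B₁, C₁])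
    (hT₂ : AffineIndependent ℝ ![A₂, B₂, C₂])
    (hT₃ : AffineIndependent ℝ ![A₃, B₃, C₃])
    -- corresponding vertices are pairwise distinct (the joining lines are genuine lines)
    (hA₁₂ : A₁ ≠ A₂) (hB₁₂ : B₁ ≠ B₂) (hC₁₂ : C₁ ≠ C₂)
    (hA₁₃ : A₁ ≠ A₃) (hB₁₃ : B₁ ≠ B₃) (hC₁₃ : C₁ ≠ C₃)
    (hA₂₃ : A₂ ≠ A₃) (hB₂₃ : B₂ ≠ B₃) (hC₂₃ : C₂ ≠ C₃)
    -- the common homology axis: `M`, `N`, `P` are collinear points lying on the sides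
    (hMNP : Collinear ℝ ({M, N, P} : Set (ℝ × ℝ)))
    (hM : M ∈ line B₁ C₁ ∧ M ∈ line B₂ C₂ ∧ M ∈ line B₃ C₃)
    (hN : N ∈ line C₁ A₁ ∧ N ∈ line C₂ A₂ ∧ N ∈ line C₃ A₃)
    (hP : P ∈ line A₁ B₁ ∧ P ∈ line A₂ B₂ ∧ P ∈ line A₃ B₃)
    -- `O₁` is the homology center of the pair (A₁B₁C₁, A₂B₂C₂), a single point:
    -- the joining lines of each pair are pairwise distinct
    (hd₁ : line A₁ A₂ ≠ line B₁ B₂) (hd₂ : line A₂ A₃ ≠ line B₂ B₃)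
    (hd₃ : line A₃ A₁ ≠ line B₃ B₁)
    (hO₁ : O₁ ∈ line A₁ A₂ ∧ O₁ ∈ line B₁ B₂ ∧ O₁ ∈ line C₁ C₂)
    -- `O₂` is the homology center of the pair (A₂B₂C₂, A₃B₃C₃)
    (hO₂ : O₂ ∈ line A₂ A₃ ∧ O₂ ∈ line B₂ B₃ ∧ O₂ ∈ line C₂ C₃)
    -- `O₃` is the homology center of the pair (A₃B₃C₃, A₁B₁C₁)
    (hO₃ : O₃ ∈ line A₃ A₁ ∧ O₃ ∈ line B₃ B₁ ∧ O₃ ∈ line C₃ C₁) :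
    Collinear ℝ ({O₁, O₂, O₃} : Set (ℝ × ℝ)) := by
  obtain ⟨t₁, ht₁⟩ := mem_affineSpan_pair_iff_exists_lineMap_eq.1 hP.1
  obtain ⟨t₂, ht₂⟩ := mem_affineSpan_pair_iff_exists_lineMap_eq.1 hP.2.1
  obtain ⟨t₃, ht₃⟩ := mem_affineSpan_pair_iff_exists_lineMap_eq.1 hP.2.2
  obtain ⟨hne, h₁⟩ := sub_smul_eq_of_lineMap_eq_lineMap hA₁₂ hB₁₂ hd₁ hO₁.1 hO₁.2.1
    (ht₁.trans ht₂.symm)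
  obtain ⟨-, h₂⟩ := sub_smul_eq_of_lineMap_eq_lineMap hA₂₃ hB₂₃ hd₂ hO₂.1 hO₂.2.1
    (ht₂.trans ht₃.symm)
  obtain ⟨-, h₃⟩ := sub_smul_eq_of_lineMap_eq_lineMap hA₁₃.symm hB₁₃.symm hd₃ hO₃.1 hO₃.2.1
    (ht₃.trans ht₁.symm)
  have hne' : t₂ - t₁ ≠ 0 := sub_ne_zero.2 hne
  refine collinear_insert_of_mem_affineSpan_pair
    (mem_affineSpan_pair_iff_exists_lineMap_eq.2 ⟨(t₃ - t₁) / (t₂ - t₁), ?_⟩)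
  rw [AffineMap.lineMap_apply_module, ← smul_right_inj hne', smul_add, smul_smul, smul_smul,
    mul_sub, mul_one, mul_div_cancel₀ _ hne']
  linear_combination (norm := module) -h₁ - h₂ - h₃
end

section
/- Let A₁B₁C₁ and A₂B₂C₂ be triangles in the real plane ℝ². Let P₁ = B₁C₁∩B₂C₂, Q₁ = B₁C₁∩A₂C₂, R₁ = B₁C₁∩A₂B₂, P₂ = A₁C₁∩A₂C₂, Q₂ = A₁C₁∩A₂B₂, R₂ = A₁C₁∩B₂C₂, P₃ = A₁B₁∩A₂B₂, Q₃ = A₁B₁∩B₂C₂, R₃ = A₁B₁∩C₂A₂, all assumed to exist as unique points distinct from the vertices of A₁B₁C₁. Let p₁, p₂, p₃, q₁, q₂, q₃, r₁, r₂, r₃ be the signed ratios defined by: B₁ − P₁ = p₁ • (C₁ − P₁), C₁ − P₂ = p₂ • (A₁ − P₂), A₁ − P₃ = p₃ • (B₁ − P₃), B₁ − Q₁ = q₁ • (C₁ − Q₁), C₁ − Q₂ = q₂ • (A₁ − Q₂), A₁ − Q₃ = q₃ • (B₁ − Q₃), B₁ − R₁ = r₁ • (C₁ − R₁), C₁ −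 R₂ = r₂ • (A₁ − R₂), A₁ − R₃ = r₃ • (B₁ − R₃). Then p₁·p₂·p₃·q₁·q₂·q₃·r₁·r₂·r₃ = 1. -/
/-- The oriented area of the parallelogram spanned by `E - D` and `X - D`. -/
def orientedArea (D E X : ℝ × ℝ) : ℝ :=
  (E.1 - D.1) * (X.2 - D.2) - (E.2 - D.2) * (X.1 - D.1)

theorem mem_line_iff_orientedArea_eq_zero {D E : ℝ × ℝ} (hDE : D ≠ E) (X : ℝ × ℝ) :
    X ∈ line D E ↔ orientedArea D E X = 0 := by
  have hpos : (E.1 - D.1) ^ 2 + (E.2 - D.2) ^ 2 ≠ 0 := by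
    contrapose! hDE
    ext <;> nlinarith [sq_nonneg (E.1 - D.1), sq_nonneg (E.2 - D.2)]
  rw [line, mem_affineSpan_pair_iff_exists_lineMap_eq, orientedArea]
  constructor
  · rintro ⟨t, rfl⟩
    simp only [AffineMap.lineMap_apply, vsub_eq_sub, vadd_eq_add, Prod.fst_add, Prod.snd_add,
      Prod.smul_fst, Prod.smul_snd, Prod.fst_sub, Prod.snd_sub, smul_eq_mul]
    ring
  · intro h
    refine ⟨((X.1 - D.1) * (E.1 - D.1) + (X.2 - D.2) * (E.2 - D.2)) /
      ((E.1 - D.1) ^ 2 + (E.2 - D.2) ^ 2), ?_⟩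
    ext <;> simp only [AffineMap.lineMap_apply, vsub_eq_sub, vadd_eq_add, Prod.fst_add,
      Prod.snd_add, Prod.smul_fst, Prod.smul_snd, Prod.fst_sub, Prod.snd_sub, smul_eq_mul] <;>
      field_simp
    · linear_combination (E.2 - D.2) * h
    · linear_combination -(E.1 - D.1) * h

theorem orientedArea_eq_mul_of_sub_eq_smul {D E U V X : ℝ × ℝ} {k : ℝ}
    (hX : orientedArea D E X = 0) (h : U - X = k • (V - X)) :
    orientedArea D E U = k * orientedArea D E V := by
  have h₁ := congrArg Prod.fst h
  have h₂ := congrArg Prod.snd h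
  simp only [Prod.fst_sub, Prod.snd_sub, Prod.smul_fst, Prod.smul_snd, smul_eq_mul] at h₁ h₂
  unfold orientedArea at *
  linear_combination (E.1 - D.1) * h₂ - (E.2 - D.2) * h₁ + (1 - k) * hX

/-- **Menelaus' theorem** for the transversal `DE` of the triangle `ABC`. -/
theorem menelaus_ratio_product_eq_one {A B C D E P Q R : ℝ × ℝ} {p q r : ℝ}
    (hT : AffineIndependent ℝ ![A, B, C]) (hDE : D ≠ E)
    (hP : P ∈ line D E) (hQ : Q ∈ line D E) (hR : R ∈ line D E)
    (hp : B - P = p • (C - P)) (hq : C - Q = q • (A - Q)) (hr : A - R = r • (B - R)) :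
    p * q * r = 1 := by
  rw [mem_line_iff_orientedArea_eq_zero hDE] at hP hQ hR
  have hB := orientedArea_eq_mul_of_sub_eq_smul hP hp
  have hC := orientedArea_eq_mul_of_sub_eq_smul hQ hq
  have hA := orientedArea_eq_mul_of_sub_eq_smul hR hr
  have hB₀ : orientedArea D E B ≠ 0 := by
    intro h
    rw [h, mul_zero] at hA
    rw [hA, mul_zero] at hC
    rw [← mem_line_iff_orientedArea_eq_zero hDE] at h hA hC
    exact affineIndependent_iff_not_collinear_set.mp hT
      (collinear_triple_of_mem_affineSpan_pair hA h hC)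
  refine mul_right_cancel₀ hB₀ ?_
  linear_combination -hB - p * hC - p * q * hA

/-- **Theorem 5.** For two triangles `A₁B₁C₁`, `A₂B₂C₂` in general position, the product
of the nine signed ratios cut on the sides of `A₁B₁C₁` by the sides of `A₂B₂C₂`
equals `1`. -/
theorem nine_ratio_product_eq_one
    (A₁ B₁ C₁ A₂ B₂ C₂ : ℝ × ℝ)
    (P₁ Q₁ R₁ P₂ Q₂ R₂ P₃ Q₃ R₃ : ℝ × ℝ)
    (p₁ p₂ p₃ q₁ q₂ q₃ r₁ r₂ r₃ : ℝ)
    -- the triangles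
    (hT₁ : AffineIndependent ℝ ![A₁, B₁, C₁])
    (hT₂ : AffineIndependent ℝ ![A₂, B₂, C₂])
    -- the nine intersection points, each on the two stated side lines
    (hP₁ : P₁ ∈ line B₁ C₁ ∧ P₁ ∈ line B₂ C₂) (huP₁ : line B₁ C₁ ≠ line B₂ C₂)
    (hQ₁ : Q₁ ∈ line B₁ C₁ ∧ Q₁ ∈ line A₂ C₂) (huQ₁ : line B₁ C₁ ≠ line A₂ C₂)
    (hR₁ : R₁ ∈ line B₁ C₁ ∧ R₁ ∈ line A₂ B₂) (huR₁ : line B₁ C₁ ≠ line A₂ B₂)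
    (hP₂ : P₂ ∈ line A₁ C₁ ∧ P₂ ∈ line A₂ C₂) (huP₂ : line A₁ C₁ ≠ line A₂ C₂)
    (hQ₂ : Q₂ ∈ line A₁ C₁ ∧ Q₂ ∈ line A₂ B₂) (huQ₂ : line A₁ C₁ ≠ line A₂ B₂)
    (hR₂ : R₂ ∈ line A₁ C₁ ∧ R₂ ∈ line B₂ C₂) (huR₂ : line A₁ C₁ ≠ line B₂ C₂)
    (hP₃ : P₃ ∈ line A₁ B₁ ∧ P₃ ∈ line A₂ B₂) (huP₃ : line A₁ B₁ ≠ line A₂ B₂)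
    (hQ₃ : Q₃ ∈ line A₁ B₁ ∧ Q₃ ∈ line B₂ C₂) (huQ₃ : line A₁ B₁ ≠ line B₂ C₂)
    (hR₃ : R₃ ∈ line A₁ B₁ ∧ R₃ ∈ line C₂ A₂) (huR₃ : line A₁ B₁ ≠ line C₂ A₂)
    -- the intersection points are distinct from the vertices of `A₁B₁C₁`
    (hvP₁ : P₁ ≠ A₁ ∧ P₁ ≠ B₁ ∧ P₁ ≠ C₁)
    (hvQ₁ : Q₁ ≠ A₁ ∧ Q₁ ≠ B₁ ∧ Q₁ ≠ C₁)
    (hvR₁ : R₁ ≠ A₁ ∧ R₁ ≠ B₁ ∧ R₁ ≠ C₁)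
    (hvP₂ : P₂ ≠ A₁ ∧ P₂ ≠ B₁ ∧ P₂ ≠ C₁)
    (hvQ₂ : Q₂ ≠ A₁ ∧ Q₂ ≠ B₁ ∧ Q₂ ≠ C₁)
    (hvR₂ : R₂ ≠ A₁ ∧ R₂ ≠ B₁ ∧ R₂ ≠ C₁)
    (hvP₃ : P₃ ≠ A₁ ∧ P₃ ≠ B₁ ∧ P₃ ≠ C₁)
    (hvQ₃ : Q₃ ≠ A₁ ∧ Q₃ ≠ B₁ ∧ Q₃ ≠ C₁)
    (hvR₃ : R₃ ≠ A₁ ∧ R₃ ≠ B₁ ∧ R₃ ≠ C₁)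
    -- the signed ratios
    (hp₁ : B₁ - P₁ = p₁ • (C₁ - P₁))
    (hp₂ : C₁ - P₂ = p₂ • (A₁ - P₂))
    (hp₃ : A₁ - P₃ = p₃ • (B₁ - P₃))
    (hq₁ : B₁ - Q₁ = q₁ • (C₁ - Q₁))
    (hq₂ : C₁ - Q₂ = q₂ • (A₁ - Q₂))
    (hq₃ : A₁ - Q₃ = q₃ • (B₁ - Q₃))
    (hr₁ : B₁ - R₁ = r₁ • (C₁ - R₁))
    (hr₂ : C₁ - R₂ = r₂ • (A₁ - R₂))
    (hr₃ : A₁ - R₃ = r₃ • (B₁ - R₃)) :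
    p₁ * p₂ * p₃ * q₁ * q₂ * q₃ * r₁ * r₂ * r₃ = 1 := by
  have hAB : A₂ ≠ B₂ := hT₂.injective.ne (show (0 : Fin 3) ≠ 1 by decide)
  have hAC : A₂ ≠ C₂ := hT₂.injective.ne (show (0 : Fin 3) ≠ 2 by decide)
  have hBC : B₂ ≠ C₂ := hT₂.injective.ne (show (1 : Fin 3) ≠ 2 by decide)
  have hR₃' : R₃ ∈ line A₂ C₂ := by
    rw [line, Set.pair_comm]
    exact hR₃.2
  have h₁ := menelaus_ratio_product_eq_one hT₁ hBC hP₁.2 hR₂.2 hQ₃.2 hp₁ hr₂ hq₃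
  have h₂ := menelaus_ratio_product_eq_one hT₁ hAC hQ₁.2 hP₂.2 hR₃' hq₁ hp₂ hr₃
  have h₃ := menelaus_ratio_product_eq_one hT₁ hAB hR₁.2 hQ₂.2 hP₃.2 hr₁ hq₂ hp₃
  calc p₁ * p₂ * p₃ * q₁ * q₂ * q₃ * r₁ * r₂ * r₃
      = (p₁ * r₂ * q₃) * (q₁ * p₂ * r₃) * (r₁ * q₂ * p₃) := by ring
    _ = 1 := by rw [h₁, h₂, h₃]; norm_num
end
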